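/- arXiv:1606.06618 — 2 statements merged into one kernel-verified Lean document; each statement's English description precedes it below -/
import Mathlib

section
/- Let h : ℝ → ℝ be absolutely continuous with |h'(t)| ≤ c for all t, where c < ∞, and let Z be a standard normal random variable. Then for every y ∈ ℝ: |h(y) - E[Z² h(Z)]| ≤ c(2(|y| + 1/√(2π)) + √(2/π)), and consequently |h(y) - E[Z² h(Z)]| ≤ 2c(y² + 2). -/
open MeasureTheory Set

/-- The standard normal density. -/
noncomputable def gaussPdf (x : ℝ) : ℝ := Real.exp (-x ^ 2 / 2) / Real.sqrt (2 * Real.pi)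

lemma gaussPdf_nonneg (x : ℝ) : 0 ≤ gaussPdf x := by
  unfold gaussPdf
  positivity

lemma integrable_pow_mul_gaussPdf (n : ℕ) : Integrable fun z : ℝ => z ^ n * gaussPdf z := by
  have h := (integrable_rpow_mul_exp_neg_mul_sq (b := 1 / 2) (by norm_num) (s := (n : ℝ))
    (by linarith [n.cast_nonneg (α := ℝ)])).div_const (Real.sqrt (2 * Real.pi))
  refine h.congr (Filter.Eventually.of_forall fun z => ?_)
  simp only [gaussPdf, Real.rpow_natCast]
  rw [show -(1 / 2) * z ^ 2 = -z ^ 2 / 2 by ring]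
  ring

lemma integrable_abs_pow_mul_gaussPdf (n : ℕ) : Integrable fun z : ℝ => |z| ^ n * gaussPdf z := by
  refine (integrable_pow_mul_gaussPdf n).norm.congr (Filter.Eventually.of_forall fun z => ?_)
  simp [abs_of_nonneg (gaussPdf_nonneg z)]

lemma integral_abs_pow_mul_gaussPdf (n : ℕ) :
    ∫ z : ℝ, |z| ^ n * gaussPdf z =
      (1 / 2 : ℝ) ^ (-((n : ℝ) + 1) / 2) * Real.Gamma (((n : ℝ) + 1) / 2) /
        Real.sqrt (2 * Real.pi) := by
  have h := integral_rpow_mul_exp_neg_mul_rpow (p := 2) (q := n) (b := 1 / 2) (by norm_num)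
    (by linarith [n.cast_nonneg (α := ℝ)]) (by norm_num)
  have h_even : ∀ z : ℝ, |z| ^ n * gaussPdf z = (fun x => x ^ n * gaussPdf x) |z| := fun z => by
    simp [gaussPdf]
  simp_rw [h_even]
  rw [integral_comp_abs (f := fun x => x ^ n * gaussPdf x)]
  have h_half : ∫ x in Ioi (0 : ℝ), x ^ n * gaussPdf x =
      (∫ x in Ioi (0 : ℝ), x ^ (n : ℝ) * Real.exp (-(1 / 2) * x ^ (2 : ℝ))) /
        Real.sqrt (2 * Real.pi) := by
    rw [← integral_div]
    congr 1
    ext x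
    rw [Real.rpow_natCast, Real.rpow_two, gaussPdf,
      show -(1 / 2) * x ^ 2 = -x ^ 2 / 2 by ring]
    ring
  rw [h_half, h]
  ring

lemma integral_sq_mul_gaussPdf : ∫ z : ℝ, z ^ 2 * gaussPdf z = 1 := by
  have h := integral_abs_pow_mul_gaussPdf 2
  simp_rw [sq_abs] at h
  have h_pow : (1 / 2 : ℝ) ^ (-(((2 : ℕ) : ℝ) + 1) / 2) = 2 * Real.sqrt 2 := by
    rw [one_div, Real.inv_rpow (by norm_num), ← Real.rpow_neg (by norm_num),
      show -(-(((2 : ℕ) : ℝ) + 1) / 2) = 1 + 1 / 2 by norm_num,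
      Real.rpow_add (by norm_num), Real.rpow_one, Real.sqrt_eq_rpow]
  have h_Gamma : Real.Gamma ((((2 : ℕ) : ℝ) + 1) / 2) = Real.sqrt Real.pi / 2 := by
    rw [show (((2 : ℕ) : ℝ) + 1) / 2 = 1 / 2 + 1 by norm_num,
      Real.Gamma_add_one (by norm_num), Real.Gamma_one_half_eq]
    ring
  rw [h, h_pow, h_Gamma, Real.sqrt_mul (by norm_num)]
  have := Real.sqrt_pos.2 Real.pi_pos
  field_simp

lemma integral_abs_cube_mul_gaussPdf :
    ∫ z : ℝ, |z| ^ 3 * gaussPdf z = 4 / Real.sqrt (2 * Real.pi) := by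
  rw [integral_abs_pow_mul_gaussPdf]
  have h_Gamma : Real.Gamma ((((3 : ℕ) : ℝ) + 1) / 2) = 1 := by
    rw [show (((3 : ℕ) : ℝ) + 1) / 2 = 2 by norm_num, Real.Gamma_two]
  rw [h_Gamma, show -(((3 : ℕ) : ℝ) + 1) / 2 = ((-2 : ℤ) : ℝ) by norm_num, Real.rpow_intCast]
  norm_num

lemma abs_sub_integral_sq_mul_gaussPdf_le {c : ℝ} {h : ℝ → ℝ} (h_cont : Continuous h)
    (h_lip : ∀ y z, |h y - h z| ≤ c * |y - z|) (y : ℝ) :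
    |h y - ∫ z, z ^ 2 * h z * gaussPdf z| ≤ c * (|y| + 4 / Real.sqrt (2 * Real.pi)) := by
  have hc : 0 ≤ c := by simpa using (abs_nonneg _).trans (h_lip 1 0)
  have h_bound_int : Integrable fun z : ℝ =>
      c * (|y| * (z ^ 2 * gaussPdf z) + |z| ^ 3 * gaussPdf z) :=
    (((integrable_pow_mul_gaussPdf 2).const_mul _).add
      (integrable_abs_pow_mul_gaussPdf 3)).const_mul _
  have h_bound : ∀ z : ℝ, ‖(h y - h z) * (z ^ 2 * gaussPdf z)‖ ≤
      c * (|y| * (z ^ 2 * gaussPdf z) + |z| ^ 3 * gaussPdf z) := fun z => by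
    have hw : 0 ≤ z ^ 2 * gaussPdf z := mul_nonneg (sq_nonneg z) (gaussPdf_nonneg z)
    rw [Real.norm_eq_abs, abs_mul, abs_of_nonneg hw]
    calc |h y - h z| * (z ^ 2 * gaussPdf z)
        ≤ (c * (|y| + |z|)) * (z ^ 2 * gaussPdf z) := by
          gcongr
          exact (h_lip y z).trans (mul_le_mul_of_nonneg_left (abs_sub y z) hc)
      _ = _ := by rw [← sq_abs z]; ring
  have h_pdf_cont : Continuous gaussPdf := by
    unfold gaussPdf
    fun_prop
  have h_diff_int : Integrable fun z : ℝ => (h y - h z) * (z ^ 2 * gaussPdf z) :=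
    h_bound_int.mono' (by fun_prop) (Filter.Eventually.of_forall h_bound)
  have h_const_int : Integrable fun z : ℝ => h y * (z ^ 2 * gaussPdf z) :=
    (integrable_pow_mul_gaussPdf 2).const_mul _
  have h_eq : h y - ∫ z, z ^ 2 * h z * gaussPdf z =
      ∫ z, (h y - h z) * (z ^ 2 * gaussPdf z) := by
    have h_split : ∀ z, z ^ 2 * h z * gaussPdf z =
        h y * (z ^ 2 * gaussPdf z) - (h y - h z) * (z ^ 2 * gaussPdf z) := fun z => by ring
    simp_rw [h_split]
    rw [integral_sub h_const_int h_diff_int, integral_const_mul, integral_sq_mul_gaussPdf]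
    ring
  rw [h_eq, ← Real.norm_eq_abs]
  refine (norm_integral_le_of_norm_le h_bound_int (Filter.Eventually.of_forall h_bound)).trans ?_
  rw [integral_const_mul, integral_add ((integrable_pow_mul_gaussPdf 2).const_mul _)
    (integrable_abs_pow_mul_gaussPdf 3), integral_const_mul, integral_sq_mul_gaussPdf,
    integral_abs_cube_mul_gaussPdf, mul_one]

/-- If `h` is absolutely continuous with a.e. derivative `h'` bounded by `c`,
then for every `y`, `|h y - E[Z² h Z]| ≤ c (2 (|y| + 1/√(2π)) + √(2/π))`, and consequently
`|h y - E[Z² h Z]| ≤ 2 c (y² + 2)`. -/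
theorem stmt5 (c : ℝ) (h h' : ℝ → ℝ)
    (hmeas : Measurable h')
    (hbd : ∀ t, |h' t| ≤ c)
    (hac : ∀ y, h y = h 0 + ∫ t in (0:ℝ)..y, h' t)
    (y : ℝ) :
    |h y - (∫ z, z ^ 2 * h z * gaussPdf z)| ≤
        c * (2 * (|y| + 1 / Real.sqrt (2 * Real.pi)) + Real.sqrt (2 / Real.pi)) ∧
    |h y - (∫ z, z ^ 2 * h z * gaussPdf z)| ≤ 2 * c * (y ^ 2 + 2) := by
  have hc : 0 ≤ c := (abs_nonneg _).trans (hbd 0)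
  have h_int : ∀ a b, IntervalIntegrable h' volume a b := fun a b =>
    (intervalIntegrable_const (c := c)).mono_fun hmeas.aestronglyMeasurable
      (Filter.Eventually.of_forall fun t => (hbd t).trans (le_abs_self c))
  have h_lip : ∀ y z, |h y - h z| ≤ c * |y - z| := fun y z => by
    rw [hac y, hac z, add_sub_add_left_eq_sub,
      intervalIntegral.integral_interval_sub_left (h_int 0 y) (h_int 0 z), ← Real.norm_eq_abs]
    exact intervalIntegral.norm_integral_le_of_norm_le_const fun t _ => hbd t
  have h_cont : Continuous h :=
    (LipschitzWith.of_dist_le_mul (K := ⟨c, hc⟩) h_lip).continuous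
  have h_main := abs_sub_integral_sq_mul_gaussPdf_le h_cont h_lip y
  have h_sqrt : Real.sqrt (2 / Real.pi) = 2 / Real.sqrt (2 * Real.pi) := by
    have := Real.sqrt_pos.2 Real.pi_pos
    rw [Real.sqrt_div (by norm_num), Real.sqrt_mul (by norm_num)]
    field_simp
    norm_num
  have h_two_le : 2 ≤ Real.sqrt (2 * Real.pi) :=
    Real.le_sqrt_of_sq_le (by linarith [Real.pi_gt_three])
  have h_inv : 4 / Real.sqrt (2 * Real.pi) ≤ 2 := by
    rw [div_le_iff₀ (by linarith)]
    linarith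
  constructor
  · refine h_main.trans (mul_le_mul_of_nonneg_left ?_ hc)
    rw [h_sqrt]
    have h_four : 4 / Real.sqrt (2 * Real.pi) =
        2 * (1 / Real.sqrt (2 * Real.pi)) + 2 / Real.sqrt (2 * Real.pi) := by ring
    linarith [abs_nonneg y]
  · rw [mul_comm 2 c, mul_assoc]
    refine h_main.trans (mul_le_mul_of_nonneg_left ?_ hc)
    nlinarith [sq_abs y, sq_nonneg (|y| - 1)]
end

section
/- Let h, c, μ, G, g be as in the context. Then g is differentiable and |g'(x)| ≤ 4c for every x ∈ ℝ. -/
open MeasureTheory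

lemma integrable_pow_mul_gauss (n : ℕ) :
    Integrable (fun y : ℝ => y ^ n * Real.exp (-y ^ 2 / 2)) := by
  have := integrable_rpow_mul_exp_neg_mul_sq (b := 1 / 2) (by norm_num) (s := n)
    (by have : (0 : ℝ) ≤ n := n.cast_nonneg
        linarith)
  refine this.congr (Filter.Eventually.of_forall fun y => ?_)
  simp only [Real.rpow_natCast]
  congr 2
  ring

lemma hasDerivAt_gauss (y : ℝ) :
    HasDerivAt (fun y : ℝ => Real.exp (-y ^ 2 / 2)) (-(y * Real.exp (-y ^ 2 / 2))) y := by
  have h : HasDerivAt (fun y : ℝ => -y ^ 2 / 2) (-y) y := by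
    refine ((hasDerivAt_pow 2 y).neg.div_const 2).congr_deriv ?_
    norm_num
    ring
  exact h.exp.congr_deriv (by ring)

lemma integral_gauss : ∫ y : ℝ, Real.exp (-y ^ 2 / 2) = Real.sqrt (2 * Real.pi) := by
  have := integral_gaussian (1 / 2)
  rw [show Real.pi / (1 / 2) = 2 * Real.pi by ring] at this
  rw [← this]
  congr 1
  ext y
  congr 1
  ring

lemma integral_pow_succ_succ_mul_gauss (n : ℕ) :
    ∫ y : ℝ, y ^ (n + 2) * Real.exp (-y ^ 2 / 2)
      = (n + 1) * ∫ y : ℝ, y ^ n * Real.exp (-y ^ 2 / 2) := by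
  have hd : ∀ y : ℝ, HasDerivAt (fun y : ℝ => y ^ (n + 1) * Real.exp (-y ^ 2 / 2))
      ((n + 1) * (y ^ n * Real.exp (-y ^ 2 / 2)) - y ^ (n + 2) * Real.exp (-y ^ 2 / 2)) y := by
    intro y
    refine ((hasDerivAt_pow (n + 1) y).mul (hasDerivAt_gauss y)).congr_deriv ?_
    push_cast
    ring
  have i1 := (integrable_pow_mul_gauss n).const_mul ((n : ℝ) + 1)
  have i2 := integrable_pow_mul_gauss (n + 2)
  have := integral_eq_zero_of_hasDerivAt_of_integrable hd (i1.sub i2)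
    (integrable_pow_mul_gauss (n + 1))
  rw [integral_sub i1 i2, integral_const_mul] at this
  linarith

lemma integral_sq_mul_gauss :
    ∫ y : ℝ, y ^ 2 * Real.exp (-y ^ 2 / 2) = Real.sqrt (2 * Real.pi) := by
  have := integral_pow_succ_succ_mul_gauss 0
  simp only [pow_zero, one_mul, integral_gauss] at this
  simpa using this

lemma integral_pow_four_mul_gauss :
    ∫ y : ℝ, y ^ 4 * Real.exp (-y ^ 2 / 2) = 3 * Real.sqrt (2 * Real.pi) := by
  have := integral_pow_succ_succ_mul_gauss 2
  rw [integral_sq_mul_gauss] at this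
  rw [this]
  norm_num

lemma integral_Ioi_mul_gauss (t : ℝ) :
    ∫ y in Set.Ioi t, y * Real.exp (-y ^ 2 / 2) = Real.exp (-t ^ 2 / 2) := by
  have hd : ∀ y : ℝ, HasDerivAt (fun y : ℝ => -Real.exp (-y ^ 2 / 2))
      (y * Real.exp (-y ^ 2 / 2)) y := fun y =>
    (hasDerivAt_gauss y).neg.congr_deriv (by ring)
  have i1 : IntegrableOn (fun y : ℝ => y * Real.exp (-y ^ 2 / 2)) (Set.Ioi t) := by
    simpa using (integrable_pow_mul_gauss 1).integrableOn (s := Set.Ioi t)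
  have i0 : IntegrableOn (fun y : ℝ => -Real.exp (-y ^ 2 / 2)) (Set.Ioi t) := by
    simpa using (integrable_pow_mul_gauss 0).neg.integrableOn (s := Set.Ioi t)
  have := integral_Ioi_of_hasDerivAt_of_tendsto' (fun y _ => hd y) i1
    (tendsto_zero_of_hasDerivAt_of_integrableOn_Ioi (fun y _ => hd y) i1 i0)
  rw [this]
  ring

lemma integral_Ioi_cube_mul_gauss (t : ℝ) :
    ∫ y in Set.Ioi t, y ^ 3 * Real.exp (-y ^ 2 / 2) = (t ^ 2 + 2) * Real.exp (-t ^ 2 / 2) := by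
  have hd : ∀ y : ℝ, HasDerivAt (fun y : ℝ => -((y ^ 2 + 2) * Real.exp (-y ^ 2 / 2)))
      (y ^ 3 * Real.exp (-y ^ 2 / 2)) y := fun y => by
    refine ((((hasDerivAt_pow 2 y).add_const 2).mul (hasDerivAt_gauss y)).neg).congr_deriv ?_
    norm_num
    ring
  have i1 := (integrable_pow_mul_gauss 3).integrableOn (s := Set.Ioi t)
  have i0 : IntegrableOn (fun y : ℝ => -((y ^ 2 + 2) * Real.exp (-y ^ 2 / 2))) (Set.Ioi t) := by
    refine (((integrable_pow_mul_gauss 2).add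
      ((integrable_pow_mul_gauss 0).const_mul 2)).neg.integrableOn (s := Set.Ioi t)).congr_fun
      (fun y _ => ?_) measurableSet_Ioi
    simp only [Pi.neg_apply, Pi.add_apply]
    ring
  have := integral_Ioi_of_hasDerivAt_of_tendsto' (fun y _ => hd y) i1
    (tendsto_zero_of_hasDerivAt_of_integrableOn_Ioi (fun y _ => hd y) i1 i0)
  rw [this]
  ring

/-- The deviation of a Lipschitz function is integrable against `y² e^{-y²/2}`. -/
lemma integrable_sq_mul_sub_mul_gauss {c : ℝ} {h : ℝ → ℝ} (hc : Continuous h)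
    (hl : ∀ x y, |h y - h x| ≤ c * |y - x|) (m : ℝ) :
    Integrable (fun y : ℝ => y ^ 2 * (h y - m) * Real.exp (-y ^ 2 / 2)) := by
  refine Integrable.mono' (g := fun y : ℝ => c * |y ^ 3 * Real.exp (-y ^ 2 / 2)|
    + |h 0 - m| * (y ^ 2 * Real.exp (-y ^ 2 / 2))) ?_ ?_ ?_
  · exact ((integrable_pow_mul_gauss 3).abs.const_mul c).add
      ((integrable_pow_mul_gauss 2).const_mul _)
  · exact (by fun_prop : Continuous _).aestronglyMeasurable
  · refine Filter.Eventually.of_forall fun y => ?_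
    have h1 : |h y - m| ≤ c * |y| + |h 0 - m| := by
      have := hl 0 y
      rw [sub_zero] at this
      calc |h y - m| = |(h y - h 0) + (h 0 - m)| := by ring_nf
        _ ≤ _ := (abs_add_le _ _).trans (by linarith)
    have he := Real.exp_pos (-y ^ 2 / 2)
    rw [Real.norm_eq_abs, abs_mul, abs_mul, abs_mul, abs_of_pos he, abs_of_nonneg (sq_nonneg y),
      abs_pow]
    calc y ^ 2 * |h y - m| * Real.exp (-y ^ 2 / 2)
        ≤ y ^ 2 * (c * |y| + |h 0 - m|) * Real.exp (-y ^ 2 / 2) := by gcongr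
      _ = _ := by
        rw [← sq_abs y]
        ring

/-- The deviation of a `c`-Lipschitz function from its mean under the density `y² φ(y)`. -/
lemma abs_sub_mean_le {c : ℝ} {h : ℝ → ℝ} (hc0 : 0 ≤ c) (hc : Continuous h)
    (hl : ∀ x y, |h y - h x| ≤ c * |y - x|) {m : ℝ}
    (hm : ∫ y : ℝ, y ^ 2 * (h y - m) * Real.exp (-y ^ 2 / 2) = 0) (s : ℝ) :
    |h s - m| ≤ c * (|s| + 2) := by
  have hS : 0 < Real.sqrt (2 * Real.pi) := Real.sqrt_pos.2 (by positivity)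
  have i2 := integrable_pow_mul_gauss 2
  have i4 := integrable_pow_mul_gauss 4
  have e1 : ∫ y : ℝ, y ^ 2 * (h y - h s) * Real.exp (-y ^ 2 / 2)
      = (m - h s) * Real.sqrt (2 * Real.pi) := by
    have : (fun y : ℝ => y ^ 2 * (h y - h s) * Real.exp (-y ^ 2 / 2)) = fun y =>
        y ^ 2 * (h y - m) * Real.exp (-y ^ 2 / 2)
          + (m - h s) * (y ^ 2 * Real.exp (-y ^ 2 / 2)) := by
      ext y
      ring
    rw [this, integral_add (integrable_sq_mul_sub_mul_gauss hc hl m) (i2.const_mul _), hm,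
      integral_const_mul, integral_sq_mul_gauss, zero_add]
  have e2 : ∫ y : ℝ, (c * (|s| + 1 / 2) * (y ^ 2 * Real.exp (-y ^ 2 / 2))
      + c / 2 * (y ^ 4 * Real.exp (-y ^ 2 / 2))) = c * (|s| + 2) * Real.sqrt (2 * Real.pi) := by
    rw [integral_add (i2.const_mul _) (i4.const_mul _), integral_const_mul, integral_const_mul,
      integral_sq_mul_gauss, integral_pow_four_mul_gauss]
    ring
  have key := norm_integral_le_of_norm_le
    (f := fun y : ℝ => y ^ 2 * (h y - h s) * Real.exp (-y ^ 2 / 2))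
    ((i2.const_mul (c * (|s| + 1 / 2))).add (i4.const_mul (c / 2)))
    (Filter.Eventually.of_forall fun y => by
      have he := Real.exp_pos (-y ^ 2 / 2)
      rw [Real.norm_eq_abs, abs_mul, abs_mul, abs_of_pos he, abs_of_nonneg (sq_nonneg y)]
      have h2 : |y - s| ≤ |s| + (1 + y ^ 2) / 2 := by
        have := abs_sub y s
        nlinarith [sq_nonneg (|y| - 1), sq_abs y]
      calc y ^ 2 * |h y - h s| * Real.exp (-y ^ 2 / 2)
          ≤ y ^ 2 * (c * (|s| + (1 + y ^ 2) / 2)) * Real.exp (-y ^ 2 / 2) := by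
            gcongr
            exact (hl s y).trans (by gcongr)
        _ = _ := by
          simp only [Pi.add_apply]
          ring)
  simp only [Pi.add_apply] at key
  rw [e1, e2, Real.norm_eq_abs, abs_mul, abs_of_pos hS, abs_sub_comm] at key
  exact le_of_mul_le_mul_right key hS

/-- Cancellation between the tail integral and the boundary term for `t ≥ 0`. -/
lemma abs_tail_sub_le {c : ℝ} {h : ℝ → ℝ} (hc0 : 0 ≤ c) (hc : Continuous h)
    (hl : ∀ x y, |h y - h x| ≤ c * |y - x|) {m : ℝ} {t : ℝ} (ht : 0 ≤ t)
    (hm : |h t - m| ≤ c * (t + 2)) :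
    |t * (Real.exp (t ^ 2 / 2) *
        ∫ y in Set.Ioi t, y ^ 2 * (h y - m) * Real.exp (-y ^ 2 / 2)) - (t ^ 2 + 2) * (h t - m)|
      ≤ 4 * c * (t + 1) := by
  set E := Real.exp (t ^ 2 / 2) with hE
  have hE0 : 0 < E := Real.exp_pos _
  have hEe : E * Real.exp (-t ^ 2 / 2) = 1 := by
    rw [hE, ← Real.exp_add, ← Real.exp_zero]
    congr 1
    ring
  have i1 : IntegrableOn (fun y : ℝ => y * Real.exp (-y ^ 2 / 2)) (Set.Ioi t) := by
    simpa using (integrable_pow_mul_gauss 1).integrableOn (s := Set.Ioi t)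
  have i2 := (integrable_pow_mul_gauss 2).integrableOn (s := Set.Ioi t)
  have i3 := (integrable_pow_mul_gauss 3).integrableOn (s := Set.Ioi t)
  set I := ∫ y in Set.Ioi t, y ^ 2 * Real.exp (-y ^ 2 / 2) with hI
  set D := ∫ y in Set.Ioi t, y ^ 2 * (h y - h t) * Real.exp (-y ^ 2 / 2) with hD
  have split : ∫ y in Set.Ioi t, y ^ 2 * (h y - m) * Real.exp (-y ^ 2 / 2)
      = D + (h t - m) * I := by
    rw [hD, hI, ← integral_const_mul,
      ← integral_add (integrable_sq_mul_sub_mul_gauss hc hl (h t)).integrableOn (i2.const_mul _)]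
    congr 1
    ext y
    ring
  have hIt : t * Real.exp (-t ^ 2 / 2) ≤ I := by
    rw [← integral_Ioi_mul_gauss, ← integral_const_mul]
    refine setIntegral_mono_on (i1.const_mul t) i2 measurableSet_Ioi fun y hy => ?_
    have hy : t < y := hy
    have := Real.exp_pos (-y ^ 2 / 2)
    nlinarith [mul_nonneg (mul_nonneg (ht.trans hy.le) (sub_nonneg.2 hy.le)) this.le]
  have hDle : |D| ≤ c * ((t ^ 2 + 2) * Real.exp (-t ^ 2 / 2) - t * I) := by
    rw [← integral_Ioi_cube_mul_gauss, hI, ← integral_const_mul, ← integral_sub i3 (i2.const_mul t),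
      ← integral_const_mul]
    refine norm_integral_le_of_norm_le (f := fun y : ℝ => y ^ 2 * (h y - h t) *
      Real.exp (-y ^ 2 / 2)) ((i3.sub (i2.const_mul t)).const_mul c) ?_
    refine (ae_restrict_iff' measurableSet_Ioi).2 (Filter.Eventually.of_forall fun y hy => ?_)
    have hy : t < y := hy
    have he := Real.exp_pos (-y ^ 2 / 2)
    rw [Real.norm_eq_abs, abs_mul, abs_mul, abs_of_pos he, abs_of_nonneg (sq_nonneg y)]
    have h1 := hl t y
    rw [abs_of_pos (sub_pos.2 hy)] at h1
    calc y ^ 2 * |h y - h t| * Real.exp (-y ^ 2 / 2)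
        ≤ y ^ 2 * (c * (y - t)) * Real.exp (-y ^ 2 / 2) := by gcongr
      _ = _ := by
        ring
  set r := t ^ 2 + 2 - t * (E * I) with hr
  have hEI : t ≤ E * I := by
    calc t = E * (t * Real.exp (-t ^ 2 / 2)) := by linear_combination (-t) * hEe
      _ ≤ E * I := by gcongr
  have hr2 : r ≤ 2 := by nlinarith
  have hED : |E * D| ≤ c * r := by
    rw [abs_mul, abs_of_pos hE0]
    calc E * |D| ≤ E * (c * ((t ^ 2 + 2) * Real.exp (-t ^ 2 / 2) - t * I)) := by gcongr
      _ = c * r := by linear_combination c * (t ^ 2 + 2) * hEe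
  have hr0 : 0 ≤ r := by
    have h0 : 0 ≤ ∫ y in Set.Ioi t, (y ^ 3 * Real.exp (-y ^ 2 / 2)
        - t * (y ^ 2 * Real.exp (-y ^ 2 / 2))) := by
      refine setIntegral_nonneg measurableSet_Ioi fun y hy => ?_
      have hy : t < y := hy
      have := mul_nonneg (mul_nonneg (sq_nonneg y) (sub_nonneg.2 hy.le))
        (Real.exp_pos (-y ^ 2 / 2)).le
      linarith
    rw [integral_sub i3 (i2.const_mul t), integral_const_mul, integral_Ioi_cube_mul_gauss] at h0
    have := mul_nonneg hE0.le h0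
    have e : E * ((t ^ 2 + 2) * Real.exp (-t ^ 2 / 2) - t * I) = r := by
      linear_combination (t ^ 2 + 2) * hEe
    exact e ▸ this
  rw [split]
  calc |t * (E * (D + (h t - m) * I)) - (t ^ 2 + 2) * (h t - m)|
      = |t * (E * D) - r * (h t - m)| := by
        congr 1
        rw [hr]
        ring
    _ ≤ |t * (E * D)| + |r * (h t - m)| := abs_sub _ _
    _ = t * |E * D| + r * |h t - m| := by
        rw [abs_mul t, abs_mul r, abs_of_nonneg ht, abs_of_nonneg hr0]
    _ ≤ t * (c * r) + r * (c * (t + 2)) := by gcongr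
    _ = r * (2 * c * (t + 1)) := by ring
    _ ≤ 2 * (2 * c * (t + 1)) := by gcongr
    _ = _ := by ring

lemma abs_sub_le_of_eq_integral {c : ℝ} {h h' : ℝ → ℝ} (hmeas : Measurable h')
    (hbd : ∀ t, |h' t| ≤ c) (hac : ∀ y, h y = h 0 + ∫ t in (0 : ℝ)..y, h' t) (x y : ℝ) :
    |h y - h x| ≤ c * |y - x| := by
  have hi : ∀ a b : ℝ, IntervalIntegrable h' volume a b := fun a b =>
    (intervalIntegrable_const (c := c)).mono_fun hmeas.aestronglyMeasurable
      (Filter.Eventually.of_forall fun t => (hbd t).trans (le_abs_self c))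
  have : h y - h x = ∫ t in x..y, h' t := by
    rw [hac y, hac x, ← intervalIntegral.integral_interval_sub_left (hi 0 y) (hi 0 x)]
    ring
  rw [this]
  exact intervalIntegral.norm_integral_le_of_norm_le_const (f := h') fun t _ => hbd t

lemma hasDerivAt_integral_Iic {f : ℝ → ℝ} (hf : Continuous f) (hi : Integrable f) (x : ℝ) :
    HasDerivAt (fun x => ∫ y in Set.Iic x, f y) (f x) x := by
  have : (fun x => ∫ y in Set.Iic x, f y)
      = fun x => (∫ y in Set.Iic 0, f y) + ∫ y in (0 : ℝ)..x, f y := by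
    ext x
    rw [← intervalIntegral.integral_Iic_sub_Iic hi.integrableOn hi.integrableOn]
    ring
  rw [this]
  exact (hf.integral_hasStrictDerivAt 0 x).hasDerivAt.const_add _

/-- With `h` absolutely continuous, `|h'| ≤ c`, `μh = E[h(X)]` for `X` with
density `x² φ(x)`, `G(x) = e^{x²/2} ∫_{-∞}^x y² (h y - μh) e^{-y²/2} dy` and
`g(x) = G(x)/(x²+2)`, the function `g` is differentiable and `|g' x| ≤ 4c` for all `x`. -/
theorem stmt17 (c : ℝ) (h h' : ℝ → ℝ) (hmeas : Measurable h') (hbd : ∀ t, |h' t| ≤ c)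
    (hac : ∀ y, h y = h 0 + ∫ t in (0:ℝ)..y, h' t)
    (μh : ℝ) (hμh : μh = ∫ y, h y * (y ^ 2 * gaussPdf y))
    (G : ℝ → ℝ)
    (hG : ∀ x, G x = Real.exp (x ^ 2 / 2) *
      ∫ y in Set.Iic x, y ^ 2 * (h y - μh) * Real.exp (-y ^ 2 / 2))
    (g : ℝ → ℝ) (hg : ∀ x, g x = G x / (x ^ 2 + 2)) :
    (∀ x, DifferentiableAt ℝ g x) ∧ (∀ x, |deriv g x| ≤ 4 * c) := by
  have hc0 : 0 ≤ c := (abs_nonneg _).trans (hbd 0)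
  have hl := abs_sub_le_of_eq_integral hmeas hbd hac
  have hc : Continuous h :=
    (LipschitzWith.of_dist_le_mul (K := ⟨c, hc0⟩) fun x y => by
      rw [Real.dist_eq, Real.dist_eq]
      exact hl y x).continuous
  have hS : 0 < Real.sqrt (2 * Real.pi) := Real.sqrt_pos.2 (by positivity)
  have hint := integrable_sq_mul_sub_mul_gauss hc hl μh
  have hcont : Continuous fun y : ℝ => y ^ 2 * (h y - μh) * Real.exp (-y ^ 2 / 2) := by fun_prop
  have hzero : ∫ y : ℝ, y ^ 2 * (h y - μh) * Real.exp (-y ^ 2 / 2) = 0 := by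
    have e : (fun y : ℝ => y ^ 2 * (h y - μh) * Real.exp (-y ^ 2 / 2)) = fun y =>
        Real.sqrt (2 * Real.pi) * (h y * (y ^ 2 * gaussPdf y))
          - μh * (y ^ 2 * Real.exp (-y ^ 2 / 2)) := by
      ext y
      rw [gaussPdf]
      field_simp
    have i1 : Integrable fun y : ℝ =>
        Real.sqrt (2 * Real.pi) * (h y * (y ^ 2 * gaussPdf y)) := by
      refine (hint.add ((integrable_pow_mul_gauss 2).const_mul μh)).congr
        (Filter.Eventually.of_forall fun y => ?_)
      simp only [Pi.add_apply, congrFun e y]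
      ring
    rw [e, integral_sub i1 ((integrable_pow_mul_gauss 2).const_mul μh), integral_const_mul,
      integral_const_mul, ← hμh, integral_sq_mul_gauss]
    ring
  have hmean := abs_sub_mean_le hc0 hc hl hzero
  have hcancel : ∀ x, |x * G x + (x ^ 2 + 2) * (h x - μh)| ≤ 4 * c * (|x| + 1) := by
    intro x
    rcases le_total 0 x with hx | hx
    · have hcompl : ∫ y in Set.Iic x, y ^ 2 * (h y - μh) * Real.exp (-y ^ 2 / 2)
          = -∫ y in Set.Ioi x, y ^ 2 * (h y - μh) * Real.exp (-y ^ 2 / 2) := by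
        have := intervalIntegral.integral_Iic_add_Ioi (b := x) hint.integrableOn hint.integrableOn
        linarith
      have hx' := hmean x
      rw [abs_of_nonneg hx] at hx' ⊢
      refine le_trans (le_of_eq ?_) (abs_tail_sub_le hc0 hc hl hx hx')
      rw [hG, hcompl, ← abs_neg]
      congr 1
      ring
    · have hrefl : ∫ y in Set.Iic x, y ^ 2 * (h y - μh) * Real.exp (-y ^ 2 / 2)
          = ∫ y in Set.Ioi (-x), y ^ 2 * (h (-y) - μh) * Real.exp (-y ^ 2 / 2) := by
        rw [← integral_comp_neg_Iic]
        simp only [neg_sq, neg_neg]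
      have hx' := hmean x
      rw [abs_of_nonpos hx] at hx' ⊢
      have := abs_tail_sub_le (h := fun y => h (-y)) (m := μh) hc0 (hc.comp continuous_neg)
        (fun a b => (hl (-a) (-b)).trans_eq (by rw [← abs_neg (b - a)]; ring_nf))
        (neg_nonneg.2 hx) (by simpa using hx')
      refine le_trans (le_of_eq ?_) this
      rw [hG, hrefl, ← abs_neg]
      simp only [neg_sq, neg_neg]
      congr 1
      ring
  have hderiv : ∀ x, HasDerivAt g
      (x ^ 2 * (x * G x + (x ^ 2 + 2) * (h x - μh)) / (x ^ 2 + 2) ^ 2) x := by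
    intro x
    have hpos : x ^ 2 + 2 ≠ 0 := by positivity
    have hE : HasDerivAt (fun x : ℝ => Real.exp (x ^ 2 / 2)) (Real.exp (x ^ 2 / 2) * x) x := by
      have : HasDerivAt (fun x : ℝ => x ^ 2 / 2) x x :=
        ((hasDerivAt_pow 2 x).div_const 2).congr_deriv (by norm_num)
      exact this.exp
    have hEe : Real.exp (x ^ 2 / 2) * Real.exp (-x ^ 2 / 2) = 1 := by
      rw [← Real.exp_add, ← Real.exp_zero]
      congr 1
      ring
    have hGd : HasDerivAt G (x * G x + x ^ 2 * (h x - μh)) x := by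
      rw [funext hG]
      refine (hE.mul (hasDerivAt_integral_Iic hcont hint x)).congr_deriv ?_
      linear_combination (x ^ 2 * (h x - μh)) * hEe
    rw [funext hg]
    refine (hGd.div ((hasDerivAt_pow 2 x).add_const 2) hpos).congr_deriv ?_
    congr 1
    norm_num
    ring
  refine ⟨fun x => (hderiv x).differentiableAt, fun x => ?_⟩
  rw [(hderiv x).deriv, abs_div, abs_mul, abs_of_nonneg (sq_nonneg x),
    abs_of_nonneg (a := (x ^ 2 + 2) ^ 2) (by positivity), div_le_iff₀ (by positivity)]
  calc x ^ 2 * |x * G x + (x ^ 2 + 2) * (h x - μh)|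
      ≤ x ^ 2 * (4 * c * (|x| + 1)) := by gcongr; exact hcancel x
    _ = 4 * c * (x ^ 2 * (|x| + 1)) := by ring
    _ ≤ 4 * c * (x ^ 2 + 2) ^ 2 := by
        gcongr
        nlinarith [sq_nonneg (|x| - 1), sq_abs x, sq_nonneg x, sq_nonneg (x ^ 2),
          mul_nonneg (sq_nonneg x) (sq_nonneg (|x| - 1))]
end
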